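/- There is a class function F : Ord → Ord such that for every uplifting cardinal κ, F maps κ into κ and the restriction F↾κ : κ → κ has the uplifting Menas property for κ: for every ordinal θ there is an inaccessible cardinal γ ≥ θ with κ < γ and a function f* : γ → γ such that ⟨V_κ, ∈, F↾κ⟩ ≺ ⟨V_γ, ∈, f*⟩ and f*(κ) ≥ θ. -/

import Mathlib

open FirstOrder Language

universe u

namespace Paper

/-- The language of set theory: a single binary relation symbol (membership).
We reuse `FirstOrder.Language.graph`, whose sole symbol is a binary relation. -/
abbrev LSet : FirstOrder.Language := FirstOrder.Language.graph

/-- The rank-initial segment `V_α` of the cumulative hierarchy, realized as the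
collection of ZF sets of rank less than `α`. -/
abbrev Vt (α : Ordinal) : Type 1 := {x : ZFSet // x.rank < α}

/-- `V_α` as a structure in the language of set theory, with the membership relation. -/
instance VtStructure (α : Ordinal) : LSet.Structure (Vt α) where
  funMap := fun f _ => f.elim
  RelMap := fun r x => match r with | .adj => (x 0).1 ∈ (x 1).1

/-- The universe of sets as a structure in the language of set theory. -/
instance ZFSetStructure : LSet.Structure ZFSet where
  funMap := fun f _ => f.elim
  RelMap := fun r x => match r with | .adj => x 0 ∈ x 1

/-- `V_α ≺ V_β`: the inclusion of `V_α` into `V_β` is an elementary embedding. -/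
def VElem (α β : Ordinal) : Prop :=
  ∃ e : Vt α ↪ₑ[LSet] Vt β, ∀ x : Vt α, (e x : ZFSet) = x

/-- An ordinal which is a cardinal. -/
def IsCardOrd (γ : Ordinal) : Prop := γ.card.ord = γ

/-- An ordinal which is a regular cardinal. -/
def IsRegularOrd (γ : Ordinal) : Prop := γ.card.IsRegular ∧ γ.card.ord = γ

/-- An ordinal which is an inaccessible cardinal (uncountable, regular, strong limit). -/
def IsInaccOrd (γ : Ordinal) : Prop := γ.card.IsInaccessible ∧ γ.card.ord = γ

/-- An inaccessible cardinal `κ` is uplifting if for every ordinal `θ` there is an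
inaccessible cardinal `γ ≥ θ` such that `V_κ ≺ V_γ` is a proper elementary extension. -/
def IsUplifting (κ : Ordinal) : Prop :=
  IsInaccOrd κ ∧ ∀ θ : Ordinal, ∃ γ : Ordinal, IsInaccOrd γ ∧ θ ≤ γ ∧ κ < γ ∧ VElem κ γ

/-- An inaccessible cardinal `κ` is pseudo uplifting if for every ordinal `θ` there is a
cardinal `γ ≥ θ` such that `V_κ ≺ V_γ` is a proper elementary extension. -/
def IsPseudoUplifting (κ : Ordinal) : Prop :=
  IsInaccOrd κ ∧ ∀ θ : Ordinal, ∃ γ : Ordinal, IsCardOrd γ ∧ θ ≤ γ ∧ κ < γ ∧ VElem κ γ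

/-- Function symbols for the language of set theory with an added unary function symbol. -/
inductive LFFun : ℕ → Type
  | fsym : LFFun 1

/-- Relation symbols for the language of set theory with an added unary function symbol. -/
inductive LFRel : ℕ → Type
  | mem : LFRel 2

/-- The language of set theory augmented by one unary function symbol. -/
def LF : FirstOrder.Language := ⟨LFFun, LFRel⟩

open Classical in
/-- The interpretation on `V_α` of the unary function symbol corresponding to an ordinal
function `f`: an element coding a von Neumann ordinal `β` is sent to the von Neumann
ordinal coding `f β` (when it lies in `V_α`), and the function is the identity off the
ordinals.  (A von Neumann ordinal is recovered from its rank.) -/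
noncomputable def fInterp (α : Ordinal) (f : Ordinal → Ordinal) (x : Vt α) : Vt α :=
  if h : x.1.IsOrdinal ∧ ∃ y : ZFSet, y.IsOrdinal ∧ y.rank = f x.1.rank ∧ y.rank < α then
    ⟨h.2.choose, h.2.choose_spec.2.2⟩
  else x

/-- The structure `⟨V_α, ∈, f⟩` for an ordinal function `f`. -/
noncomputable def LFStructure (α : Ordinal) (f : Ordinal → Ordinal) : LF.Structure (Vt α) where
  funMap := fun r x => match r with | .fsym => fInterp α f (x 0)
  RelMap := fun r x => match r with | .mem => (x 0).1 ∈ (x 1).1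

/-- `⟨V_α, ∈, f⟩ ≺ ⟨V_β, ∈, g⟩`: the inclusion of `V_α` into `V_β` is an elementary
embedding of the expanded structures. -/
def FVElem (α β : Ordinal) (f g : Ordinal → Ordinal) : Prop :=
  letI := LFStructure α f
  letI := LFStructure β g
  ∃ e : Vt α ↪ₑ[LF] Vt β, ∀ x : Vt α, (e x : ZFSet) = x

/-- `f : κ → κ` has the uplifting Menas property for `κ`: for every ordinal `θ` there is an
inaccessible cardinal `γ ≥ θ` with `κ < γ` and a function `f* : γ → γ` such that
`⟨V_κ, ∈, f⟩ ≺ ⟨V_γ, ∈, f*⟩` and `f*(κ) ≥ θ`. -/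
def MenasFor (f : Ordinal → Ordinal) (κ : Ordinal) : Prop :=
  (∀ δ < κ, f δ < κ) ∧
  ∀ θ : Ordinal, ∃ (γ : Ordinal) (g : Ordinal → Ordinal),
    IsInaccOrd γ ∧ θ ≤ γ ∧ κ < γ ∧ (∀ δ < γ, g δ < γ) ∧ FVElem κ γ f g ∧ θ ≤ g κ

open ZFSet Order

/-! ### Uniformly definable predicates on limit levels of the cumulative hierarchy -/

/-- A predicate on assignments into the levels `V_α` is uniformly definable if a single formula of
the language of set theory defines it in `V_α` for every limit ordinal `α`. -/
def UDef {ι : Type*} (P : ∀ α : Ordinal, (ι → Vt α) → Prop) : Prop :=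
  ∃ φ : LSet.Formula ι, ∀ α : Ordinal, IsSuccLimit α → ∀ v : ι → Vt α, φ.Realize v ↔ P α v

namespace UDef

variable {ι : Type*}

theorem congr {P Q : ∀ α : Ordinal, (ι → Vt α) → Prop} (h : UDef P)
    (hPQ : ∀ α, IsSuccLimit α → ∀ v, P α v ↔ Q α v) : UDef Q := by
  obtain ⟨φ, hφ⟩ := h
  exact ⟨φ, fun α hα v => (hφ α hα v).trans (hPQ α hα v)⟩

theorem reindex {κ : Type*} {P : ∀ α : Ordinal, (ι → Vt α) → Prop} (h : UDef P) (f : ι → κ) :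
    UDef (fun α (v : κ → Vt α) => P α (fun i => v (f i))) := by
  obtain ⟨φ, hφ⟩ := h
  exact ⟨φ.relabel f, fun α hα v => Formula.realize_relabel.trans (hφ α hα _)⟩

theorem false : UDef (fun α (_ : ι → Vt α) => False) :=
  ⟨⊥, fun _ _ _ => Iff.rfl⟩

theorem mem (i j : ι) : UDef (fun α (v : ι → Vt α) => (v i).1 ∈ (v j).1) := by
  refine ⟨Relations.formula₂ adj (Term.var i) (Term.var j), fun α _ v => ?_⟩
  rw [Formula.realize_rel₂]
  rfl

theorem eq (i j : ι) : UDef (fun α (v : ι → Vt α) => v i = v j) :=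
  ⟨Term.equal (Term.var i) (Term.var j), fun _ _ _ => Formula.realize_equal⟩

theorem valEq (i j : ι) : UDef (fun α (v : ι → Vt α) => (v i).1 = (v j).1) :=
  (eq i j).congr fun _ _ _ => Subtype.ext_iff

theorem imp {P Q : ∀ α : Ordinal, (ι → Vt α) → Prop} (hP : UDef P) (hQ : UDef Q) :
    UDef (fun α v => P α v → Q α v) := by
  obtain ⟨φ, hφ⟩ := hP
  obtain ⟨ψ, hψ⟩ := hQ
  refine ⟨φ.imp ψ, fun α hα v => ?_⟩
  rw [Formula.realize_imp, hφ α hα, hψ α hα]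

theorem not {P : ∀ α : Ordinal, (ι → Vt α) → Prop} (hP : UDef P) :
    UDef (fun α v => ¬ P α v) :=
  hP.imp false

theorem and {P Q : ∀ α : Ordinal, (ι → Vt α) → Prop} (hP : UDef P) (hQ : UDef Q) :
    UDef (fun α v => P α v ∧ Q α v) :=
  (hP.imp hQ.not).not.congr fun _ _ _ => by tauto

theorem or {P Q : ∀ α : Ordinal, (ι → Vt α) → Prop} (hP : UDef P) (hQ : UDef Q) :
    UDef (fun α v => P α v ∨ Q α v) :=
  (hP.not.imp hQ).congr fun _ _ _ => by tauto

theorem iff {P Q : ∀ α : Ordinal, (ι → Vt α) → Prop} (hP : UDef P) (hQ : UDef Q) :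
    UDef (fun α v => P α v ↔ Q α v) :=
  ((hP.imp hQ).and (hQ.imp hP)).congr fun _ _ _ => by tauto

theorem all {P : ∀ α : Ordinal, (ι → Vt α) → Vt α → Prop}
    (h : UDef (fun α (w : Option ι → Vt α) => P α (fun i => w (some i)) (w none))) :
    UDef (fun α v => ∀ x : Vt α, P α v x) := by
  obtain ⟨φ, hφ⟩ := h
  refine ⟨(φ.relabel (fun o => o.elim (Sum.inr ()) Sum.inl : Option ι → ι ⊕ Unit)).iAlls Unit,
    fun α hα v => ?_⟩
  rw [Formula.realize_iAlls]
  simp only [Formula.realize_relabel, hφ α hα]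
  exact ⟨fun h x => h fun _ => x, fun h x => h (x ())⟩

theorem ex {P : ∀ α : Ordinal, (ι → Vt α) → Vt α → Prop}
    (h : UDef (fun α (w : Option ι → Vt α) => P α (fun i => w (some i)) (w none))) :
    UDef (fun α v => ∃ x : Vt α, P α v x) :=
  (all (P := fun α v x => ¬ P α v x) h.not).not.congr fun _ _ _ => by simp

theorem ball {P : ∀ α : Ordinal, (ι → Vt α) → ZFSet → Prop} (i : ι)
    (h : UDef (fun α (w : Option ι → Vt α) => P α (fun i => w (some i)) (w none).1)) :
    UDef (fun α v => ∀ x ∈ (v i).1, P α v x) := by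
  refine (all (P := fun α v x => x.1 ∈ (v i).1 → P α v x.1) ((mem none (some i)).imp h)).congr
    fun α _ v => ⟨fun h x hx => h ⟨x, (rank_lt_of_mem hx).trans (v i).2⟩ hx, fun h x hx => h x.1 hx⟩

theorem bex {P : ∀ α : Ordinal, (ι → Vt α) → ZFSet → Prop} (i : ι)
    (h : UDef (fun α (w : Option ι → Vt α) => P α (fun i => w (some i)) (w none).1)) :
    UDef (fun α v => ∃ x ∈ (v i).1, P α v x) :=
  (ball (P := fun α v x => ¬ P α v x) i h.not).not.congr fun _ _ _ => by simp

theorem subset (i j : ι) : UDef (fun α (v : ι → Vt α) => (v i).1 ⊆ (v j).1) :=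
  (ball (P := fun _ v x => x ∈ (v j).1) i (mem none (some j))).congr fun _ _ _ => Iff.rfl

theorem ballSubset {P : ∀ α : Ordinal, (ι → Vt α) → ZFSet → Prop} (i : ι)
    (h : UDef (fun α (w : Option ι → Vt α) => P α (fun i => w (some i)) (w none).1)) :
    UDef (fun α v => ∀ x ⊆ (v i).1, P α v x) := by
  refine (all (P := fun α v x => x.1 ⊆ (v i).1 → P α v x.1) ((subset none (some i)).imp h)).congr
    fun α _ v => ⟨fun h x hx => h ⟨x, (rank_mono hx).trans_lt (v i).2⟩ hx, fun h x hx => h x.1 hx⟩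

theorem bexSubset {P : ∀ α : Ordinal, (ι → Vt α) → ZFSet → Prop} (i : ι)
    (h : UDef (fun α (w : Option ι → Vt α) => P α (fun i => w (some i)) (w none).1)) :
    UDef (fun α v => ∃ x ⊆ (v i).1, P α v x) :=
  (ballSubset (P := fun α v x => ¬ P α v x) i h.not).not.congr fun _ _ _ => by simp

theorem bexFamily {P : ∀ α : Ordinal, (ι → Vt α) → ZFSet → Prop} (i : ι)
    (h : UDef (fun α (w : Option ι → Vt α) => P α (fun i => w (some i)) (w none).1)) :
    UDef (fun α v => ∃ D ⊆ powerset (v i).1, P α v D) := by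
  refine (ex (P := fun α v x => (∀ y ∈ x.1, y ⊆ (v i).1) ∧ P α v x.1)
    ((ball none (subset none (some (some i)))).and h)).congr fun α hα v => ⟨?_, ?_⟩
  · rintro ⟨x, hx, hP⟩
    exact ⟨x.1, fun y hy => mem_powerset.2 (hx y hy), hP⟩
  · rintro ⟨D, hD, hP⟩
    refine ⟨⟨D, (rank_mono hD).trans_lt ?_⟩, fun y hy => mem_powerset.1 (hD hy), hP⟩
    rw [rank_powerset]
    exact hα.succ_lt (v i).2

theorem eqSingleton (i j : ι) : UDef (fun α (v : ι → Vt α) => (v i).1 = {(v j).1}) :=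
  ((mem j i).and (ball (P := fun α v x => x = (v j).1) i (valEq none (some j)))).congr
    fun α _ v => by
      constructor
      · rintro ⟨h, h'⟩
        ext z
        rw [mem_singleton]
        exact ⟨h' z, fun hz => hz ▸ h⟩
      · intro h
        simp [h]

theorem eqInsertSingleton (i j k : ι) :
    UDef (fun α (v : ι → Vt α) => (v i).1 = {(v j).1, (v k).1}) :=
  ((mem j i).and ((mem k i).and (ball (P := fun α v x => x = (v j).1 ∨ x = (v k).1) i
    ((valEq none (some j)).or (valEq none (some k)))))).congr
    fun α _ v => by
      constructor
      · rintro ⟨h, h', h''⟩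
        ext z
        rw [mem_pair]
        refine ⟨h'' z, ?_⟩
        rintro (rfl | rfl) <;> assumption
      · intro h
        simp [h]

theorem eqPair (i j k : ι) :
    UDef (fun α (v : ι → Vt α) => (v i).1 = pair (v j).1 (v k).1) :=
  ((bex (P := fun α v x => x = {(v j).1}) i (eqSingleton none (some j))).and
    ((bex (P := fun α v x => x = {(v j).1, (v k).1}) i
      (eqInsertSingleton none (some j) (some k))).and
    (ball (P := fun α v x => x = {(v j).1} ∨ x = {(v j).1, (v k).1}) i
      ((eqSingleton none (some j)).or (eqInsertSingleton none (some j) (some k)))))).congr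
    fun α _ v => by
      constructor
      · rintro ⟨⟨a, h, rfl⟩, ⟨b, h', rfl⟩, h''⟩
        ext z
        rw [pair, mem_pair]
        refine ⟨h'' z, ?_⟩
        rintro (rfl | rfl) <;> assumption
      · intro h
        simp [h, pair]

theorem pairMem (i j k : ι) :
    UDef (fun α (v : ι → Vt α) => pair (v i).1 (v j).1 ∈ (v k).1) :=
  (bex (P := fun α v x => x = pair (v i).1 (v j).1) k (eqPair none (some i) (some j))).congr
    fun _ _ _ => by simp

theorem isTransitive (i : ι) : UDef (fun α (v : ι → Vt α) => (v i).1.IsTransitive) :=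
  ball i (subset none (some i))

theorem isOrdinal (i : ι) : UDef (fun α (v : ι → Vt α) => (v i).1.IsOrdinal) :=
  ((isTransitive i).and (ball (P := fun _ _ x => x.IsTransitive) i (isTransitive none))).congr
    fun _ _ _ => isOrdinal_iff_forall_mem_isTransitive.symm

end UDef

/-! ### Internal description of the levels and of elementarity -/

/-- `h` is a history: each of its members `x` is the union of the power sets of the members
of `x ∩ h`. -/
def IsHistory (h : ZFSet) : Prop :=
  ∀ x ∈ h, (∀ y ∈ x, ∃ c ∈ x, c ∈ h ∧ y ⊆ c) ∧ ∀ c ∈ x, c ∈ h → ∀ y ⊆ c, y ∈ x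

/-- `u` is a level of the cumulative hierarchy. -/
def IsLevel (u : ZFSet) : Prop :=
  ∃ h ⊆ u, IsHistory h ∧ (∀ y ∈ u, ∃ c ∈ h, y ⊆ c) ∧ ∀ c ∈ h, ∀ y ⊆ c, y ∈ u

/-- `u` has no largest member with respect to `∈`, and it satisfies second-order collection. -/
def IsClosedLevel (u : ZFSet) : Prop :=
  (∀ x ∈ u, ∃ y ∈ u, x ∈ y) ∧
  ∀ x ∈ u, ∀ r ⊆ u, (∀ y ∈ x, ∃ z ∈ u, ∀ a ∈ u, pair y a ∈ r → a ∈ z) →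
    ∃ w ∈ u, ∀ y ∈ x, ∀ a ∈ u, pair y a ∈ r → a ∈ w

/-- Read as codes for assignments, whose value at `j` is `{y | pair j y ∈ s}`, the sets `s` and `t`
agree in all variables other than `i`. -/
def AgreeOff (u i s t : ZFSet) : Prop :=
  ∀ j ∈ u, j ≠ i → ∀ y ∈ u, (pair j y ∈ s ↔ pair j y ∈ t)

/-- The value at `i` of the assignment coded by `s` is a member of its value at `j`. -/
def ValueMem (u s i j : ZFSet) : Prop :=
  ∃ a ∈ u, (∀ y ∈ u, (y ∈ a ↔ pair i y ∈ s)) ∧ pair j a ∈ s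

/-- `D` is a family of sets of (codes of) assignments into `u` which is closed under the
set-theoretic counterparts of the formation rules for formulas. -/
def IsDefFamily (u D : ZFSet) : Prop :=
  (∀ i ∈ u, ∀ j ∈ u, ∃ X ∈ D, ∀ s ∈ u, (s ∈ X ↔ ValueMem u s i j)) ∧
  (∀ i ∈ u, ∀ j ∈ u, ∃ X ∈ D, ∀ s ∈ u, (s ∈ X ↔ ∀ y ∈ u, (pair i y ∈ s ↔ pair j y ∈ s))) ∧
  (∃ X ∈ D, ∀ s ∈ u, s ∉ X) ∧
  (∀ X ∈ D, ∀ Y ∈ D, ∃ Z ∈ D, ∀ s ∈ u, (s ∈ Z ↔ (s ∈ X → s ∈ Y))) ∧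
  ∀ i ∈ u, ∀ X ∈ D, ∃ Y ∈ D, ∀ s ∈ u, (s ∈ Y ↔ ∀ t ∈ u, AgreeOff u i s t → t ∈ X)

/-- The Tarski–Vaught criterion for `d` in `u`, in terms of a family of definable sets. -/
def IsElemIn (d u : ZFSet) : Prop :=
  ∃ D ⊆ powerset u, IsDefFamily u D ∧
    ∀ X ∈ D, ∀ i ∈ d, ∀ s ∈ d, ∀ t ∈ u, AgreeOff u i s t → t ∈ X →
      ∃ t' ∈ d, AgreeOff u i s t' ∧ t' ∈ X

/-- `u` is an inaccessible level of which the level `d` is a proper elementary substructure. -/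
def IsTarget (d u : ZFSet) : Prop :=
  d ∈ u ∧ IsClosedLevel u ∧ IsElemIn d u

namespace UDef

variable {ι : Type*}

theorem isLevel (i : ι) : UDef (fun α (v : ι → Vt α) => IsLevel (v i).1) := by
  unfold IsLevel IsHistory
  repeat' first
    | exact mem _ _ | exact subset _ _
    | apply and | apply imp | apply bexSubset | apply ballSubset | apply bex | apply ball

theorem isTarget (i j : ι) : UDef (fun α (v : ι → Vt α) => IsTarget (v i).1 (v j).1) := by
  unfold IsTarget IsClosedLevel IsElemIn IsDefFamily ValueMem AgreeOff
  repeat' first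
    | exact mem _ _ | exact subset _ _ | exact pairMem _ _ _ | exact (valEq _ _).not
    | apply bexFamily | apply bexSubset | apply ballSubset | apply bex | apply ball
    | apply not | apply and | apply iff | apply imp

end UDef

/-! ### Correctness of the description of levels -/

theorem eq_vonNeumann_rank_of_cover {x A : ZFSet} (hA : ∀ c ∈ A, c = V_ c.rank)
    (hx : ∀ y ∈ x, ∃ c ∈ A, y ⊆ c) (hx' : ∀ c ∈ A, ∀ y ⊆ c, y ∈ x) : x = V_ x.rank := by
  ext y
  rw [mem_vonNeumann]
  refine ⟨rank_lt_of_mem, fun hy => ?_⟩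
  obtain ⟨z, hz, hyz⟩ := lt_rank_iff.1 hy
  obtain ⟨c, hc, hzc⟩ := hx z hz
  refine hx' c hc y ?_
  rw [hA c hc, subset_vonNeumann]
  exact hyz.trans (rank_mono hzc)

theorem IsHistory.eq_vonNeumann_rank {h : ZFSet} (hh : IsHistory h) (x : ZFSet) (hx : x ∈ h) :
    x = V_ x.rank := by
  induction x using ZFSet.inductionOn with
  | _ x ih =>
    refine eq_vonNeumann_rank_of_cover (A := x ∩ h) ?_ ?_ ?_
    · intro c hc
      rw [mem_inter] at hc
      exact ih c hc.1 hc.2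
    · intro y hy
      obtain ⟨c, hc, hc', hyc⟩ := (hh x hx).1 y hy
      exact ⟨c, mem_inter.2 ⟨hc, hc'⟩, hyc⟩
    · intro c hc
      rw [mem_inter] at hc
      exact (hh x hx).2 c hc.1 hc.2

theorem isLevel_iff {u : ZFSet} : IsLevel u ↔ u = V_ u.rank := by
  constructor
  · rintro ⟨h, -, hh, h₁, h₂⟩
    exact eq_vonNeumann_rank_of_cover hh.eq_vonNeumann_rank h₁ h₂
  · intro hu
    have key : ∀ γ, ∀ y ∈ V_ γ, V_ y.rank ∈ V_ γ := fun γ y hy => by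
      rw [mem_vonNeumann] at hy
      simpa using hy
    rw [hu]
    generalize u.rank = γ
    refine ⟨(V_ γ).sep fun x => x = V_ x.rank, fun x hx => (mem_sep.1 hx).1, ?_, ?_, ?_⟩
    · intro x hx
      obtain ⟨hxγ, hx⟩ := mem_sep.1 hx
      rw [hx]
      refine ⟨fun y hy => ⟨V_ y.rank, key _ y hy, mem_sep.2 ⟨?_, by simp⟩,
        subset_vonNeumann_self y⟩, fun c hc _ y hy => mem_vonNeumann_of_subset hy hc⟩
      exact key _ _ (isTransitive_vonNeumann γ _ hxγ (by rw [hx]; exact hy))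
    · exact fun y hy => ⟨V_ y.rank, mem_sep.2 ⟨key _ y hy, by simp⟩, subset_vonNeumann_self y⟩
    · exact fun c hc y hy => mem_vonNeumann_of_subset hy (mem_sep.1 hc).1

theorem isLevel_vonNeumann (γ : Ordinal) : IsLevel (V_ γ) :=
  isLevel_iff.2 (by simp)

/-! ### Coding assignments by sets -/

theorem rank_pair_lt {γ : Ordinal} (hγ : IsSuccLimit γ) {x y : ZFSet} (hx : x.rank < γ)
    (hy : y.rank < γ) : (pair x y).rank < γ := by
  simp only [pair, ZFSet.rank_pair, rank_singleton]
  exact max_lt (hγ.succ_lt (hγ.succ_lt hx))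
    (hγ.succ_lt (max_lt (hγ.succ_lt hx) (hγ.succ_lt hy)))

/-- The value at `j` of the assignment coded by `s`. -/
noncomputable def value (s j : ZFSet) : ZFSet :=
  (⋃₀ (⋃₀ s : ZFSet) : ZFSet).sep fun y => pair j y ∈ s

theorem mem_value {s j y : ZFSet} : y ∈ value s j ↔ pair j y ∈ s := by
  rw [value, mem_sep]
  refine ⟨And.right, fun h => ⟨?_, h⟩⟩
  rw [mem_sUnion]
  refine ⟨{j, y}, mem_sUnion.2 ⟨_, h, ?_⟩, ?_⟩ <;> simp [pair]

theorem rank_value_le (s j : ZFSet) : (value s j).rank ≤ s.rank :=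
  (rank_mono fun _ hy => (mem_sep.1 hy).1).trans ((rank_sUnion_le _).trans (rank_sUnion_le _))

/-- The code `s` changed so as to take the value `x` at `i`. -/
noncomputable def updateCode (s i x : ZFSet) : ZFSet :=
  (s.sep fun p => ∀ y, p ≠ pair i y) ∪ ZFSet.prod {i} x

theorem value_updateCode_self (s i x : ZFSet) : value (updateCode s i x) i = x := by
  ext y
  simp [mem_value, updateCode]

theorem value_updateCode_of_ne (s x : ZFSet) {i j : ZFSet} (h : j ≠ i) :
    value (updateCode s i x) j = value s j := by
  ext y
  simp [mem_value, updateCode, h]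

theorem rank_updateCode_lt {γ : Ordinal} (hγ : IsSuccLimit γ) {s i x : ZFSet} (hs : s.rank < γ)
    (hi : i.rank < γ) (hx : x.rank < γ) : (updateCode s i x).rank < γ := by
  rw [updateCode, rank_union]
  refine max_lt ((rank_mono fun _ hy => (mem_sep.1 hy).1).trans_lt hs) ?_
  have hμ : max i.rank x.rank < γ := max_lt hi hx
  refine lt_of_le_of_lt (rank_le_iff.2 ?_) (hγ.succ_lt (hγ.succ_lt (hγ.succ_lt hμ)))
  intro p hp
  obtain ⟨a, ha, b, hb, rfl⟩ := mem_prod.1 hp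
  obtain rfl := mem_singleton.1 ha
  have ha' := succ_le_succ (le_max_left a.rank x.rank)
  have hb' := succ_le_succ ((rank_lt_of_mem hb).le.trans (le_max_right a.rank x.rank))
  simp only [pair, ZFSet.rank_pair, rank_singleton]
  exact lt_succ_of_le (max_le (succ_le_succ ha') (succ_le_succ (max_le ha' hb')))

/-- The assignment coded by an element of a level. -/
noncomputable def valuation {γ : Ordinal} (s : Vt γ) (j : ZFSet) : Vt γ :=
  ⟨value s.1 j, (rank_value_le _ _).trans_lt s.2⟩

theorem value_eq_of_agreeOff {γ : Ordinal} {i s t : ZFSet} (hs : s.rank < γ)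
    (ht : t.rank < γ) (h : AgreeOff (V_ γ) i s t) {j : ZFSet} (hj : j ≠ i) :
    value s j = value t j := by
  have aux : ∀ s : ZFSet, s.rank < γ → ∀ y, pair j y ∈ s → j ∈ V_ γ ∧ y ∈ V_ γ := by
    intro s hs y hy
    have hp : pair j y ∈ V_ γ := mem_vonNeumann.2 ((rank_lt_of_mem hy).trans hs)
    have hjy : {j, y} ∈ V_ γ := (isTransitive_vonNeumann γ).subset_of_mem hp (by simp [pair])
    exact ⟨(isTransitive_vonNeumann γ).subset_of_mem hjy (by simp),
      (isTransitive_vonNeumann γ).subset_of_mem hjy (by simp)⟩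
  ext y
  rw [mem_value, mem_value]
  exact ⟨fun hy => (h j (aux s hs y hy).1 hj y (aux s hs y hy).2).1 hy,
    fun hy => (h j (aux t ht y hy).1 hj y (aux t ht y hy).2).2 hy⟩

theorem agreeOff_updateCode (u s i x : ZFSet) : AgreeOff u i s (updateCode s i x) := by
  intro j _ hj y _
  rw [← mem_value, ← mem_value, value_updateCode_of_ne _ _ hj]

theorem valueMem_iff {γ : Ordinal} {s i j : ZFSet} (hs : s.rank < γ) :
    ValueMem (V_ γ) s i j ↔ value s i ∈ value s j := by
  constructor
  · rintro ⟨a, ha, h, h'⟩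
    convert mem_value.2 h'
    ext y
    rw [mem_value]
    refine ⟨fun hy => (h y ?_).2 hy, fun hy => (h y ?_).1 hy⟩
    · exact mem_vonNeumann.2
        ((rank_lt_of_mem (mem_value.2 hy)).trans_le (rank_value_le s i) |>.trans hs)
    · exact mem_vonNeumann.2 ((rank_lt_of_mem hy).trans (mem_vonNeumann.1 ha))
  · intro h
    exact ⟨value s i, mem_vonNeumann.2 ((rank_value_le s i).trans_lt hs), fun y _ => mem_value,
      mem_value.1 h⟩

theorem forall_pair_mem_iff {γ : Ordinal} {s i j : ZFSet} (hs : s.rank < γ) :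
    (∀ y ∈ V_ γ, (pair i y ∈ s ↔ pair j y ∈ s)) ↔ value s i = value s j := by
  constructor
  · intro h
    have aux : ∀ k, ∀ y ∈ value s k, y ∈ V_ γ := fun k y hy =>
      mem_vonNeumann.2 (((rank_lt_of_mem hy).trans_le (rank_value_le s k)).trans hs)
    ext y
    exact ⟨fun hy => mem_value.2 ((h y (aux _ _ hy)).1 (mem_value.1 hy)),
      fun hy => mem_value.2 ((h y (aux _ _ hy)).2 (mem_value.1 hy))⟩
  · intro h y _
    rw [← mem_value, ← mem_value, h]

/-! ### The internal Tarski–Vaught criterion expresses elementarity -/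

theorem rank_natCast_lt {γ : Ordinal} (hγ : IsSuccLimit γ) (n : ℕ) :
    (Ordinal.toZFSet n).rank < γ := by
  rw [Ordinal.rank_toZFSet]
  exact (Ordinal.natCast_lt_omega0 n).trans_le (Ordinal.omega0_le_of_isSuccLimit hγ)

theorem natCast_toZFSet_ne {m n : ℕ} (h : m ≠ n) :
    Ordinal.toZFSet (m : Ordinal.{0}) ≠ Ordinal.toZFSet n :=
  fun h' => h (by exact_mod_cast Ordinal.toZFSet_injective h')

theorem exists_code {δ : Ordinal} (hδ : IsSuccLimit δ) {n : ℕ} (x : Fin n → Vt δ) :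
    ∃ s : Vt δ, ∀ k : Fin n, valuation s (Ordinal.toZFSet (k : ℕ)) = x k := by
  induction n with
  | zero => exact ⟨⟨∅, by simpa using hδ.bot_lt⟩, fun k => k.elim0⟩
  | succ n ih =>
    obtain ⟨s, hs⟩ := ih (fun k => x k.castSucc)
    refine ⟨⟨updateCode s.1 (Ordinal.toZFSet n) (x (Fin.last n)).1,
      rank_updateCode_lt hδ s.2 (rank_natCast_lt hδ n) (x (Fin.last n)).2⟩, fun k => ?_⟩
    refine Fin.lastCases ?_ (fun k => ?_) k
    · exact Subtype.ext (value_updateCode_self _ _ _)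
    · rw [← hs k]
      exact Subtype.ext (value_updateCode_of_ne _ _ (natCast_toZFSet_ne k.2.ne))

theorem IsDefFamily.exists_realize_iff {γ : Ordinal} (hγ : IsSuccLimit γ) {D : ZFSet}
    (hD : IsDefFamily (V_ γ) D) {n : ℕ} (φ : LSet.BoundedFormula Empty n) :
    ∃ X ∈ D, ∀ s : Vt γ, s.1 ∈ X ↔
      φ.Realize default (fun k : Fin n => valuation s (Ordinal.toZFSet (k : ℕ))) := by
  obtain ⟨hmem, heq, hbot, himp, hall⟩ := hD
  have hnat : ∀ n : ℕ, Ordinal.toZFSet n ∈ V_ γ := fun n => mem_vonNeumann.2 (rank_natCast_lt hγ n)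
  have hterm : ∀ {n : ℕ} (t : LSet.Term (Empty ⊕ Fin n)), ∃ k, t = Term.var (Sum.inr k) := by
    intro n t
    rcases t with ((e | k) | f)
    · exact e.elim
    · exact ⟨k, rfl⟩
    · exact f.elim
  induction φ with
  | falsum =>
    obtain ⟨X, hX, h⟩ := hbot
    exact ⟨X, hX, fun s => ⟨fun hs => h s.1 (mem_vonNeumann.2 s.2) hs, False.elim⟩⟩
  | equal t₁ t₂ =>
    obtain ⟨k, rfl⟩ := hterm t₁
    obtain ⟨l, rfl⟩ := hterm t₂
    obtain ⟨X, hX, h⟩ := heq _ (hnat k) _ (hnat l)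
    refine ⟨X, hX, fun s => (h s.1 (mem_vonNeumann.2 s.2)).trans ?_⟩
    rw [forall_pair_mem_iff s.2]
    exact (Subtype.ext_iff (a1 := valuation s _) (a2 := valuation s _)).symm
  | rel R ts =>
    cases R
    obtain ⟨k, hk⟩ := hterm (ts 0)
    obtain ⟨l, hl⟩ := hterm (ts 1)
    obtain ⟨X, hX, h⟩ := hmem _ (hnat k) _ (hnat l)
    refine ⟨X, hX, fun s => (h s.1 (mem_vonNeumann.2 s.2)).trans ?_⟩
    rw [valueMem_iff s.2]
    change _ ↔ (Term.realize _ (ts 0) : Vt γ).1 ∈ (Term.realize _ (ts 1) : Vt γ).1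
    rw [hk, hl]
    rfl
  | imp φ ψ ihφ ihψ =>
    obtain ⟨X, hX, h⟩ := ihφ
    obtain ⟨Y, hY, h'⟩ := ihψ
    obtain ⟨Z, hZ, h''⟩ := himp X hX Y hY
    refine ⟨Z, hZ, fun s => (h'' s.1 (mem_vonNeumann.2 s.2)).trans ?_⟩
    rw [h, h', BoundedFormula.realize_imp]
  | @all n φ ih =>
    obtain ⟨X, hX, h⟩ := ih
    obtain ⟨Y, hY, h'⟩ := hall _ (hnat n) X hX
    refine ⟨Y, hY, fun s => (h' s.1 (mem_vonNeumann.2 s.2)).trans ?_⟩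
    have key : ∀ t : Vt γ, AgreeOff (V_ γ) (Ordinal.toZFSet n) s.1 t.1 →
        (fun k : Fin (n + 1) => valuation t (Ordinal.toZFSet (k : ℕ))) =
          Fin.snoc (fun k : Fin n => valuation s (Ordinal.toZFSet (k : ℕ)))
            (valuation t (Ordinal.toZFSet n)) := by
      intro t ht
      funext k
      refine Fin.lastCases ?_ (fun k => ?_) k
      · simp
      · rw [Fin.snoc_castSucc]
        exact Subtype.ext
          (value_eq_of_agreeOff s.2 t.2 ht (natCast_toZFSet_ne k.2.ne)).symm
    rw [BoundedFormula.realize_all]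
    constructor
    · intro hs a
      let t : Vt γ := ⟨updateCode s.1 (Ordinal.toZFSet n) a.1,
        rank_updateCode_lt hγ s.2 (rank_natCast_lt hγ n) a.2⟩
      have ht := agreeOff_updateCode (V_ γ) s.1 (Ordinal.toZFSet n) a.1
      have := (h t).1 (hs t.1 (mem_vonNeumann.2 t.2) ht)
      rw [key t ht] at this
      rwa [show valuation t (Ordinal.toZFSet n) = a from
        Subtype.ext (value_updateCode_self _ _ _)] at this
    · intro hs t ht hst
      refine (h ⟨t, mem_vonNeumann.1 ht⟩).2 ?_
      rw [key ⟨t, mem_vonNeumann.1 ht⟩ hst]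
      exact hs _

/-- The inclusion of a level into a larger one. -/
def inclusion {δ γ : Ordinal} (h : δ ≤ γ) (x : Vt δ) : Vt γ :=
  ⟨x.1, x.2.trans_le h⟩

theorem velem_of_isElemIn {δ γ : Ordinal} (hδ : IsSuccLimit δ) (hγ : IsSuccLimit γ) (hlt : δ < γ)
    (h : IsElemIn (V_ δ) (V_ γ)) : VElem δ γ := by
  obtain ⟨D, -, hD, htv⟩ := h
  let f : Vt δ ↪[LSet] Vt γ :=
    { toFun := inclusion hlt.le
      inj' := fun x y hxy => Subtype.ext
        (show (inclusion hlt.le x).1 = (inclusion hlt.le y).1 from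
          congrArg (fun z : Vt γ => z.1) hxy)
      map_fun' := fun f => f.elim
      map_rel' := fun r x => by cases r; exact Iff.rfl }
  refine ⟨f.toElementaryEmbedding ?_, fun x => rfl⟩
  intro n φ x a hφ
  obtain ⟨X, hX, h⟩ := hD.exists_realize_iff hγ φ
  obtain ⟨s, hs⟩ := exists_code hδ x
  have hsγ : s.1.rank < γ := s.2.trans hlt
  have key : ∀ t : Vt γ, AgreeOff (V_ γ) (Ordinal.toZFSet n) s.1 t.1 →
      (fun k : Fin (n + 1) => valuation t (Ordinal.toZFSet (k : ℕ))) =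
        Fin.snoc (f ∘ x) (valuation t (Ordinal.toZFSet n)) := by
    intro t ht
    funext k
    refine Fin.lastCases ?_ (fun k => ?_) k
    · simp
    · rw [Fin.snoc_castSucc, Function.comp_apply, ← hs k]
      exact Subtype.ext
        (value_eq_of_agreeOff hsγ t.2 ht (natCast_toZFSet_ne k.2.ne)).symm
  let t : Vt γ := ⟨updateCode s.1 (Ordinal.toZFSet n) a.1,
    rank_updateCode_lt hγ hsγ (rank_natCast_lt hγ n) a.2⟩
  have hst := agreeOff_updateCode (V_ γ) s.1 (Ordinal.toZFSet n) a.1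
  have htX : t.1 ∈ X := by
    rw [h, key t hst]
    rwa [show valuation t (Ordinal.toZFSet n) = a from
        Subtype.ext (value_updateCode_self _ _ _)]
  obtain ⟨t', ht', hst', ht'X⟩ := htv X hX _ (mem_vonNeumann.2 (rank_natCast_lt hδ n)) s.1
    (mem_vonNeumann.2 s.2) t.1 (mem_vonNeumann.2 t.2) hst htX
  refine ⟨valuation ⟨t', mem_vonNeumann.1 ht'⟩ (Ordinal.toZFSet n), ?_⟩
  have := (h (inclusion hlt.le ⟨t', mem_vonNeumann.1 ht'⟩)).1 ht'X
  rwa [key _ hst'] at this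

theorem UDef.velem_iff {ι : Type*} {P : ∀ α : Ordinal, (ι → Vt α) → Prop} (hP : UDef P)
    {δ γ : Ordinal} (hδ : IsSuccLimit δ) (hγ : IsSuccLimit γ) (hle : δ ≤ γ) (h : VElem δ γ)
    (v : ι → Vt δ) : P γ (fun i => inclusion hle (v i)) ↔ P δ v := by
  obtain ⟨φ, hφ⟩ := hP
  obtain ⟨e, he⟩ := h
  rw [← hφ δ hδ, ← hφ γ hγ, ← e.map_formula]
  have : (fun i => inclusion hle (v i)) = e ∘ v := funext fun i => Subtype.ext (he (v i)).symm
  rw [this]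

open Classical in
theorem UDef.allAt {ι : Type*} {P : ∀ α : Ordinal, (ι → Vt α) → Prop} (hP : UDef P) (i : ι) :
    UDef (fun α v => ∀ x : Vt α, P α (Function.update v i x)) := by
  refine UDef.all ((hP.reindex fun j => if j = i then none else some j).congr fun α _ w => ?_)
  have : (fun j => w (if j = i then none else some j)) =
      Function.update (fun j => w (some j)) i (w none) := by
    funext j
    by_cases h : j = i
    · subst h; simp
    · simp [h]
  rw [this]

open Classical in
theorem valuation_eq_update {γ : Ordinal} {i : ZFSet} {s t : Vt γ}
    (h : AgreeOff (V_ γ) i s.1 t.1) :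
    valuation t = Function.update (valuation s) i (valuation t i) := by
  funext j
  by_cases hj : j = i
  · subst hj; simp
  · rw [Function.update_of_ne hj]
    exact Subtype.ext (value_eq_of_agreeOff s.2 t.2 h hj).symm

open Classical in
theorem isElemIn_of_velem {δ γ : Ordinal} (hδ : IsSuccLimit δ) (hγ : IsSuccLimit γ) (hlt : δ < γ)
    (h : VElem δ γ) : IsElemIn (V_ δ) (V_ γ) := by
  let D := (powerset (V_ γ)).sep fun X => ∃ P : ∀ α : Ordinal, (ZFSet → Vt α) → Prop,
    UDef P ∧ ∀ s : Vt γ, s.1 ∈ X ↔ P γ (valuation s)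
  have intro : ∀ {P : ∀ α : Ordinal, (ZFSet → Vt α) → Prop} {Q : ZFSet → Prop}, UDef P →
      (∀ s : Vt γ, P γ (valuation s) ↔ Q s.1) → ∃ X ∈ D, ∀ s ∈ V_ γ, (s ∈ X ↔ Q s) := by
    intro P Q hP hPQ
    have hX : ∀ s ∈ V_ γ, (s ∈ (V_ γ).sep Q ↔ Q s) := fun s hs => by simp [mem_sep, hs]
    refine ⟨(V_ γ).sep Q, mem_sep.2 ⟨mem_powerset.2 fun s hs => (mem_sep.1 hs).1, P, hP,
      fun s => ?_⟩, hX⟩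
    rw [hX s.1 (mem_vonNeumann.2 s.2), hPQ]
  refine ⟨D, fun X hX => (mem_sep.1 hX).1, ⟨?_, ?_, ?_, ?_, ?_⟩, ?_⟩
  · intro i _ j _
    exact intro (UDef.mem i j) fun s => (valueMem_iff s.2).symm
  · intro i _ j _
    exact intro (UDef.valEq i j) fun s => (forall_pair_mem_iff s.2).symm
  · obtain ⟨X, hX, h⟩ := intro (Q := fun _ => False) UDef.false fun s => Iff.rfl
    exact ⟨X, hX, fun s hs => (h s hs).1⟩
  · intro X hX Y hY
    obtain ⟨-, P, hP, hPX⟩ := mem_sep.1 hX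
    obtain ⟨-, Q, hQ, hQY⟩ := mem_sep.1 hY
    exact intro (hP.imp hQ) fun s => by rw [hPX, hQY]
  · intro i hi X hX
    obtain ⟨-, P, hP, hPX⟩ := mem_sep.1 hX
    refine intro (hP.allAt i) fun s => ⟨fun hs t ht hst => ?_, fun hs x => ?_⟩
    · have := hs (valuation ⟨t, mem_vonNeumann.1 ht⟩ i)
      rw [← valuation_eq_update (t := ⟨t, mem_vonNeumann.1 ht⟩) hst] at this
      exact (hPX _).2 this
    · let t : Vt γ := ⟨updateCode s.1 i x.1, rank_updateCode_lt hγ s.2 (mem_vonNeumann.1 hi) x.2⟩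
      have hst := agreeOff_updateCode (V_ γ) s.1 i x.1
      have := (hPX t).1 (hs t.1 (mem_vonNeumann.2 t.2) hst)
      rw [valuation_eq_update hst] at this
      rwa [show valuation t i = x from Subtype.ext (value_updateCode_self _ _ _)] at this
  · intro X hX i hi s hs t ht hst htX
    obtain ⟨-, P, hP, hPX⟩ := mem_sep.1 hX
    have hEx : UDef fun α v => ¬ ∀ x : Vt α, ¬ P α (Function.update v i x) := (hP.not.allAt i).not
    let s' : Vt δ := ⟨s, mem_vonNeumann.1 hs⟩
    have hs' : (fun j => inclusion hlt.le (valuation s' j)) =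
      valuation (inclusion hlt.le s') := rfl
    have := (hEx.velem_iff hδ hγ hlt.le h (valuation s')).1 (by
      rw [hs', _root_.not_forall_not]
      refine ⟨valuation ⟨t, mem_vonNeumann.1 ht⟩ i, ?_⟩
      rw [← valuation_eq_update (s := inclusion hlt.le s') (t := ⟨t, mem_vonNeumann.1 ht⟩) hst]
      exact (hPX _).1 htX)
    rw [_root_.not_forall_not] at this
    obtain ⟨x, hx⟩ := this
    rw [← hP.velem_iff hδ hγ hlt.le h] at hx
    let t' : Vt δ := ⟨updateCode s i x.1, rank_updateCode_lt hδ s'.2 (mem_vonNeumann.1 hi) x.2⟩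
    have hst' := agreeOff_updateCode (V_ γ) s i x.1
    refine ⟨t'.1, mem_vonNeumann.2 t'.2, hst', (hPX (inclusion hlt.le t')).2 ?_⟩
    rw [valuation_eq_update (s := inclusion hlt.le s') hst']
    convert hx using 1
    funext j
    by_cases hj : j = i
    · subst hj
      simp only [Function.update_self]
      exact Subtype.ext (value_updateCode_self _ _ _)
    · simp only [Function.update_of_ne hj]
      rfl

theorem isElemIn_iff {δ γ : Ordinal} (hδ : IsSuccLimit δ) (hγ : IsSuccLimit γ) (hlt : δ < γ) :
    IsElemIn (V_ δ) (V_ γ) ↔ VElem δ γ :=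
  ⟨velem_of_isElemIn hδ hγ hlt, isElemIn_of_velem hδ hγ hlt⟩

/-! ### Closed levels are the inaccessible ones -/

theorem IsInaccOrd.isSuccLimit {γ : Ordinal} (h : IsInaccOrd γ) : IsSuccLimit γ :=
  h.2 ▸ Cardinal.isSuccLimit_ord h.1.aleph0_lt.le

theorem IsClosedLevel.isSuccLimit {γ : Ordinal} (hγ : 0 < γ) (h : IsClosedLevel (V_ γ)) :
    IsSuccLimit γ := by
  refine (Order.isSuccLimit_iff _).2 ⟨hγ.not_isMin, isSuccPrelimit_of_succ_lt fun β hβ => ?_⟩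
  obtain ⟨y, hy, hβy⟩ := h.1 (Ordinal.toZFSet β) (mem_vonNeumann.2 (by rwa [Ordinal.rank_toZFSet]))
  have := rank_lt_of_mem hβy
  rw [Ordinal.rank_toZFSet] at this
  exact (succ_le_of_lt this).trans_lt (mem_vonNeumann.1 hy)

theorem IsClosedLevel.exists_bound {γ : Ordinal} (hγ : IsSuccLimit γ) (h : IsClosedLevel (V_ γ))
    {x : ZFSet} (hx : x.rank < γ) {f : ZFSet → Ordinal} (hf : ∀ y ∈ x, f y < γ) :
    ∃ β < γ, ∀ y ∈ x, f y < β := by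
  let r := (V_ γ).sep fun p => ∃ y ∈ x, p = pair y (Ordinal.toZFSet (f y))
  obtain ⟨w, hw, hxw⟩ := h.2 x (mem_vonNeumann.2 hx) r (fun p hp => (mem_sep.1 hp).1) (by
    intro y hy
    refine ⟨{Ordinal.toZFSet (f y)}, mem_vonNeumann.2 ?_, fun a _ ha => ?_⟩
    · rw [rank_singleton, Ordinal.rank_toZFSet]
      exact hγ.succ_lt (hf y hy)
    · obtain ⟨-, z, -, hz⟩ := mem_sep.1 ha
      obtain ⟨rfl, rfl⟩ := pair_inj.1 hz
      simp)
  refine ⟨w.rank, mem_vonNeumann.1 hw, fun y hy => ?_⟩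
  have hrank : (Ordinal.toZFSet (f y)).rank < γ := by
    rw [Ordinal.rank_toZFSet]
    exact hf y hy
  have := rank_lt_of_mem (hxw y hy (Ordinal.toZFSet (f y)) (mem_vonNeumann.2 hrank)
    (mem_sep.2 ⟨mem_vonNeumann.2 (rank_pair_lt hγ ((rank_lt_of_mem hy).trans hx) hrank),
      y, hy, rfl⟩))
  rwa [Ordinal.rank_toZFSet] at this

theorem IsClosedLevel.exists_bound_of_card_le {γ : Ordinal.{u}} (hγ : IsSuccLimit γ)
    (h : IsClosedLevel (V_ γ)) {x : ZFSet.{u}} (hx : x.rank < γ) {ι : Type u}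
    (hι : Cardinal.mk ι ≤ x.card) {g : ι → Ordinal} (hg : ∀ i, g i < γ) :
    ∃ β < γ, ∀ i, g i < β := by
  obtain ⟨e⟩ := hι
  let k : ι → ZFSet := fun i => ((equivShrink x).symm (e i)).1
  have hk : Function.Injective k := fun i j hij =>
    e.injective ((equivShrink x).symm.injective (Subtype.ext hij))
  obtain ⟨β, hβ, H⟩ := h.exists_bound hγ hx (f := Function.extend k g 0) (fun y _ => by
    by_cases hy : ∃ i, k i = y
    · obtain ⟨i, rfl⟩ := hy
      rw [hk.extend_apply]
      exact hg i
    · rw [Function.extend_apply' _ _ _ hy]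
      exact hγ.bot_lt)
  refine ⟨β, hβ, fun i => ?_⟩
  have := H (k i) ((equivShrink x).symm (e i)).2
  rwa [hk.extend_apply] at this

theorem IsClosedLevel.card_lt {γ : Ordinal} (hγ : IsSuccLimit γ) (h : IsClosedLevel (V_ γ))
    {x : ZFSet} (hx : x.rank < γ) : x.card < γ.card := by
  by_contra! hle
  rw [← Cardinal.mk_toType] at hle
  obtain ⟨β, hβ, H⟩ := h.exists_bound_of_card_le hγ hx hle
    (g := fun i => (Ordinal.ToType.mk.symm i).1) fun i => (Ordinal.ToType.mk.symm i).2
  simpa using H (Ordinal.ToType.mk ⟨β, hβ⟩)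

theorem IsClosedLevel.isInaccOrd {κ γ : Ordinal} (hκ : IsInaccOrd κ) (hκγ : κ < γ)
    (h : IsClosedLevel (V_ γ)) : IsInaccOrd γ := by
  have hγ := h.isSuccLimit (pos_of_gt hκγ)
  have hcard : γ.card.ord = γ := by
    refine (Cardinal.ord_card_le γ).antisymm (not_lt.1 fun hlt => ?_)
    have := h.card_lt hγ (x := Ordinal.toZFSet γ.card.ord) (by rwa [Ordinal.rank_toZFSet])
    rw [Ordinal.card_toZFSet, Cardinal.card_ord] at this
    exact this.false
  have hord : ∀ {c : Cardinal}, c < γ.card → c.ord < γ := fun hc => by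
    rw [← hcard]
    exact Cardinal.ord_lt_ord.2 hc
  refine ⟨⟨hκ.1.aleph0_lt.trans_le (Ordinal.card_le_card hκγ.le), ?_, fun c hc => ?_⟩, hcard⟩
  · rw [hcard]
    by_contra! hlt
    obtain ⟨s, hs, hcof⟩ := Order.exists_cof_eq γ.ToType
    rw [Ordinal.cof_toType] at hcof
    obtain ⟨β, hβ, H⟩ := h.exists_bound_of_card_le hγ (x := Ordinal.toZFSet γ.cof.ord)
      (by rw [Ordinal.rank_toZFSet]; exact hord hlt) (ι := s)
      (by rw [hcof, Ordinal.card_toZFSet, Cardinal.card_ord])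
      (g := fun i => (Ordinal.ToType.mk.symm i.1).1) fun i => (Ordinal.ToType.mk.symm i.1).2
    obtain ⟨i, hi, hβi⟩ := hs (Ordinal.ToType.mk ⟨β, hβ⟩)
    have h' := H ⟨i, hi⟩
    have : (⟨β, hβ⟩ : Set.Iio γ) ≤ Ordinal.ToType.mk.symm i := by
      rwa [OrderIso.le_symm_apply]
    exact (h'.trans_le this).false
  · have := h.card_lt hγ (x := powerset (Ordinal.toZFSet c.ord)) (by
      rw [rank_powerset, Ordinal.rank_toZFSet]
      exact hγ.succ_lt (hord hc))
    rwa [card_powerset, Ordinal.card_toZFSet, Cardinal.card_ord] at this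

theorem IsInaccOrd.isClosedLevel {γ : Ordinal} (h : IsInaccOrd γ) : IsClosedLevel (V_ γ) := by
  have hγ := h.isSuccLimit
  refine ⟨fun x hx => ⟨{x}, mem_vonNeumann.2 ?_, mem_singleton.2 rfl⟩, fun x hx r _ H => ?_⟩
  · rw [rank_singleton]
    exact hγ.succ_lt (mem_vonNeumann.1 hx)
  · choose! z hz hz' using H
    have hcard : x.card < γ.cof := by
      rw [← h.2]
      refine lt_of_lt_of_le ?_ h.1.le_cof_ord
      rw [← h.1.preBeth_ord, h.2]
      refine ((card_mono (subset_vonNeumann_self x)).trans (card_vonNeumann _).le).trans_lt ?_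
      exact Cardinal.preBeth_strictMono (mem_vonNeumann.1 hx)
    have hsup := Ordinal.iSup_lt_of_lt_cof hcard
      (f := fun i => (z ((equivShrink x).symm i).1).rank)
      fun i => mem_vonNeumann.1 (hz _ ((equivShrink x).symm i).2)
    refine ⟨V_ _, mem_vonNeumann.2 (by rwa [rank_vonNeumann]), fun y hy a ha hya =>
      mem_vonNeumann.2 ((rank_lt_of_mem (hz' y hy a ha hya)).trans_le ?_)⟩
    have := Ordinal.le_iSup (fun i => (z ((equivShrink x).symm i).1).rank) (equivShrink x ⟨y, hy⟩)
    simpa using this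

theorem isTarget_iff {κ γ : Ordinal} (hκ : IsInaccOrd κ) :
    IsTarget (V_ κ) (V_ γ) ↔ κ < γ ∧ IsInaccOrd γ ∧ VElem κ γ := by
  rw [IsTarget, mem_vonNeumann, rank_vonNeumann]
  refine and_congr_right fun hlt => ?_
  have hiff : IsClosedLevel (V_ γ) ↔ IsInaccOrd γ :=
    ⟨fun h => h.isInaccOrd hκ hlt, fun h => h.isClosedLevel⟩
  rw [hiff]
  exact and_congr_right fun hγ => isElemIn_iff hκ.isSuccLimit hγ.isSuccLimit hlt

/-! ### The Menas function -/

/-- No target `V_γ` of `V_δ` with `γ < l` has `γ > β`. -/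
def IsBound (l δ β : Ordinal) : Prop :=
  ∀ γ < l, IsTarget (V_ δ) (V_ γ) → γ ≤ β

/-- The least upper bound below `l` of the targets of `V_δ` below `l`, if there is one, and
`0` otherwise. -/
noncomputable def menasAt (l δ : Ordinal) : Ordinal :=
  sInf {β | β < l ∧ IsBound l δ β}

/-- The supremum of all targets of `V_δ` if they are bounded, and `0` otherwise. -/
noncomputable def menas (δ : Ordinal) : Ordinal :=
  sInf {β | ∀ γ, IsTarget (V_ δ) (V_ γ) → γ ≤ β}

theorem menasAt_lt {l : Ordinal} (hl : 0 < l) (δ : Ordinal) : menasAt l δ < l := by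
  rw [menasAt]
  rcases Set.eq_empty_or_nonempty {β | β < l ∧ IsBound l δ β} with h | h
  · rwa [h, Ordinal.sInf_empty]
  · exact (csInf_mem h).1

theorem eq_menasAt_iff {l δ β : Ordinal} (hβ : β < l) :
    β = menasAt l δ ↔ (∀ z < β, ¬ IsBound l δ z) ∧
      (IsBound l δ β ∨ β = 0 ∧ ∀ z < l, ¬ IsBound l δ z) := by
  constructor
  · rintro rfl
    refine ⟨fun z hz hb => (csInf_le' ⟨hz.trans hβ, hb⟩ : menasAt l δ ≤ z).not_gt hz, ?_⟩
    rcases Set.eq_empty_or_nonempty {β | β < l ∧ IsBound l δ β} with h | h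
    · refine Or.inr ⟨by rw [menasAt, h, Ordinal.sInf_empty], fun z hz hb => ?_⟩
      exact (h ▸ (⟨hz, hb⟩ : z ∈ {β | β < l ∧ IsBound l δ β}) : z ∈ (∅ : Set Ordinal))
    · exact Or.inl (csInf_mem h).2
  · rintro ⟨h, hb | ⟨rfl, hb⟩⟩
    · refine le_antisymm (le_csInf ⟨β, hβ, hb⟩ fun z hz => ?_) (csInf_le' ⟨hβ, hb⟩)
      exact not_lt.1 fun hlt => h z hlt hz.2
    · have : {β | β < l ∧ IsBound l δ β} = ∅ :=
        Set.eq_empty_of_forall_notMem fun z hz => hb z hz.1 hz.2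
      rw [menasAt, this, Ordinal.sInf_empty]

theorem isBound_iff {α : Ordinal} (x y : Vt α) :
    IsBound α x.1.rank y.1.rank ↔ ∀ d u : Vt α, IsLevel d.1 → x.1 ⊆ d.1 → x.1 ∉ d.1 →
      IsLevel u.1 → IsTarget d.1 u.1 → y.1 ∉ u.1 := by
  constructor
  · intro h d u hd hxd hxd' hu ht
    have hrank : d.1.rank = x.1.rank := by
      refine le_antisymm (not_lt.1 fun hlt => hxd' ?_) (rank_mono hxd)
      rw [isLevel_iff.1 hd]
      exact mem_vonNeumann.2 hlt
    rw [isLevel_iff.1 hd, isLevel_iff.1 hu, hrank] at ht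
    rw [isLevel_iff.1 hu, mem_vonNeumann, not_lt]
    exact h _ u.2 ht
  · intro h γ hγ ht
    have := h ⟨V_ x.1.rank, by simpa using x.2⟩ ⟨V_ γ, by simpa using hγ⟩ (isLevel_vonNeumann _)
      (subset_vonNeumann_self _) (by simp [mem_vonNeumann]) (isLevel_vonNeumann _) ht
    simpa [mem_vonNeumann] using this

theorem fInterp_eq_iff {α : Ordinal} {f : Ordinal → Ordinal} (hf : ∀ δ < α, f δ < α)
    (x y : Vt α) : fInterp α f x = y ↔
      (x.1.IsOrdinal ∧ y.1.IsOrdinal ∧ y.1.rank = f x.1.rank) ∨ (¬ x.1.IsOrdinal ∧ y = x) := by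
  by_cases hx : x.1.IsOrdinal
  · have h : x.1.IsOrdinal ∧ ∃ y : ZFSet, y.IsOrdinal ∧ y.rank = f x.1.rank ∧ y.rank < α :=
      ⟨hx, Ordinal.toZFSet (f x.1.rank), isOrdinal_toZFSet _, Ordinal.rank_toZFSet _,
        (Ordinal.rank_toZFSet _).trans_lt (hf _ x.2)⟩
    rw [fInterp, dif_pos h]
    simp only [hx, true_and, not_true_eq_false, false_and, or_false]
    have hs := h.2.choose_spec
    constructor
    · rintro rfl
      exact ⟨hs.1, hs.2.1⟩
    · rintro ⟨hy, hr⟩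
      exact Subtype.ext ((hs.1.rank_inj hy).1 (hs.2.1.trans hr.symm))
  · rw [fInterp, dif_neg fun h => hx h.1]
    simp [hx, eq_comm]

theorem LFStructure_congr {α : Ordinal} {f g : Ordinal → Ordinal} (hg : ∀ δ < α, g δ < α)
    (h : ∀ δ < α, f δ = g δ) : LFStructure α f = LFStructure α g := by
  have : fInterp α f = fInterp α g := by
    funext x
    rw [fInterp_eq_iff fun δ hδ => (h δ hδ).trans_lt (hg δ hδ), h _ x.2, ← fInterp_eq_iff hg]
  rw [LFStructure, this, LFStructure]

/-- The expansion of `V_α` by the function `menasAt α`. -/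
noncomputable instance menasStructure (α : Ordinal) : LF.Structure (Vt α) :=
  LFStructure α (menasAt α)

namespace UDef

theorem isBound {ι : Type*} (i j : ι) :
    UDef (fun α (v : ι → Vt α) => IsBound α (v i).1.rank (v j).1.rank) := by
  refine UDef.congr (P := fun α v => ∀ d u : Vt α, IsLevel d.1 → (v i).1 ⊆ d.1 → (v i).1 ∉ d.1 →
    IsLevel u.1 → IsTarget d.1 u.1 → (v j).1 ∉ u.1) ?_ fun α _ v => (isBound_iff _ _).symm
  exact all (all ((isLevel _).imp ((subset (some (some i)) (some none)).imp
    ((mem (some (some i)) (some none)).not.imp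
      ((isLevel _).imp ((isTarget _ _).imp (mem (some (some j)) none).not))))))

theorem eqMenasAt {ι : Type*} (i j : ι) :
    UDef (fun α (v : ι → Vt α) =>
      (v j).1.IsOrdinal ∧ (v j).1.rank = menasAt α (v i).1.rank) := by
  refine UDef.congr (P := fun α v => (v j).1.IsOrdinal ∧
    (∀ z ∈ (v j).1, ¬ IsBound α (v i).1.rank z.rank) ∧
      (IsBound α (v i).1.rank (v j).1.rank ∨
        (∀ z ∈ (v j).1, False) ∧ ∀ z : Vt α, ¬ IsBound α (v i).1.rank z.1.rank))
    ((isOrdinal j).and ((ball j (isBound (some i) none).not).and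
      ((isBound i j).or ((ball (P := fun _ _ _ => False) j false).and
        (all (isBound (some i) none).not))))) fun α _ v => ?_
  refine and_congr_right fun hy => ?_
  rw [eq_menasAt_iff (v j).2]
  have hmem : ∀ z : Ordinal, z < (v j).1.rank → Ordinal.toZFSet z ∈ (v j).1 := fun z hz => by
    rw [← hy.toZFSet_rank_eq]
    exact Ordinal.mem_toZFSet_iff.2 ⟨z, hz, rfl⟩
  refine and_congr ⟨fun h z hz => ?_, fun h z hz => h _ (rank_lt_of_mem hz)⟩
    (or_congr_right (and_congr ⟨fun h => ?_, fun h z hz => ?_⟩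
      ⟨fun h z hz => ?_, fun h z => h _ z.2⟩))
  · simpa using h _ (hmem z hz)
  · exact nonpos_iff_eq_zero.1 (not_lt.1 fun hlt => h _ (hmem 0 hlt))
  · exact not_lt_zero ((rank_lt_of_mem hz).trans_eq h)
  · simpa using h ⟨Ordinal.toZFSet z, by simpa using hz⟩

theorem fInterpEq {ι : Type*} (i j : ι) :
    UDef (fun α (v : ι → Vt α) => fInterp α (menasAt α) (v i) = v j) :=
  (((isOrdinal i).and (eqMenasAt i j)).or ((isOrdinal i).not.and (eq j i))).congr
    fun _ hα _ => (fInterp_eq_iff (fun _ _ => menasAt_lt hα.bot_lt _) _ _).symm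

theorem realizeTerm {ι : Type*} (t : LF.Term ι) :
    UDef (fun α (v : Option ι → Vt α) => t.realize (fun i => v (some i)) = v none) := by
  induction t with
  | var i => exact eq (some i) none
  | func f ts ih =>
    cases f
    refine UDef.congr (P := fun α v => ∃ z : Vt α,
      (ts 0).realize (fun i => v (some i)) = z ∧ fInterp α (menasAt α) z = v none)
      (ex (((ih 0).reindex fun o => o.elim none fun i => some (some i)).and
        (fInterpEq none (some none)))) fun α _ v => ?_
    rw [exists_eq_left']
    rfl

theorem realizeFormula {β : Type*} {n : ℕ} (φ : LF.BoundedFormula β n) :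
    UDef (fun α (v : β ⊕ Fin n → Vt α) =>
      φ.Realize (fun b => v (Sum.inl b)) (fun k => v (Sum.inr k))) := by
  have elim_eq : ∀ {n : ℕ} {α : Ordinal} (v : β ⊕ Fin n → Vt α),
      Sum.elim (fun b => v (Sum.inl b)) (fun k => v (Sum.inr k)) = v := fun v => by
    funext i
    cases i <;> rfl
  induction φ with
  | falsum => exact false
  | equal t₁ t₂ =>
    refine (ex (P := fun α v x => t₁.realize v = x ∧ t₂.realize v = x)
      ((realizeTerm t₁).and (realizeTerm t₂))).congr fun α _ v => ?_
    rw [exists_eq_left', BoundedFormula.Realize, elim_eq]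
    exact eq_comm
  | rel R ts =>
    cases R
    refine UDef.congr (P := fun α v => ∃ x y : Vt α,
      (ts 0).realize v = x ∧ (ts 1).realize v = y ∧ x.1 ∈ y.1)
      (ex (ex (((realizeTerm (ts 0)).reindex fun o => o.elim (some none) fun i => some (some i)).and
        (((realizeTerm (ts 1)).reindex fun o => o.elim none fun i => some (some i)).and
          (mem (some none) none))))) fun α _ v => ?_
    simp only [exists_and_left, exists_eq_left']
    change _ ↔ (Term.realize (Sum.elim _ _) (ts 0) : Vt α).1 ∈
      (Term.realize (Sum.elim _ _) (ts 1) : Vt α).1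
    rw [elim_eq]
  | imp φ ψ ihφ ihψ => exact ihφ.imp ihψ
  | @all n φ ih =>
    refine UDef.all ((ih.reindex (Sum.elim (fun b => some (Sum.inl b))
      fun k => Fin.lastCases none (fun k => some (Sum.inr k)) k)).congr fun α _ w => ?_)
    have : (fun k : Fin (n + 1) => w (Sum.elim (fun b => some (Sum.inl b))
        (fun k => Fin.lastCases none (fun k => some (Sum.inr k)) k) (Sum.inr k : β ⊕ Fin (n + 1)))) =
        Fin.snoc (fun k => w (some (Sum.inr k))) (w none) := by
      funext k
      refine Fin.lastCases ?_ (fun k => ?_) k <;> simp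
    rw [this]
    rfl

end UDef

theorem VElem.fvelem {κ l : Ordinal} (hκ : IsSuccLimit κ) (hl : IsSuccLimit l) (hle : κ ≤ l)
    (h : VElem κ l) : FVElem κ l (menasAt κ) (menasAt l) := by
  refine ⟨{ toFun := inclusion hle, map_formula' := fun n φ x => ?_ }, fun x => rfl⟩
  have := (UDef.realizeFormula φ).velem_iff hκ hl hle h (Sum.elim x Fin.elim0)
  rw [Formula.Realize, Formula.Realize, Subsingleton.elim default Fin.elim0,
    Subsingleton.elim default Fin.elim0]
  convert this using 2 <;> rfl

theorem isBound_iff_of_velem {κ l : Ordinal} (hκ : IsSuccLimit κ) (hl : IsSuccLimit l)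
    (hle : κ ≤ l) (h : VElem κ l) {δ β : Ordinal} (hδ : δ < κ) (hβ : β < κ) :
    IsBound l δ β ↔ IsBound κ δ β := by
  have := (UDef.isBound (0 : Fin 2) 1).velem_iff hκ hl hle h
    ![⟨Ordinal.toZFSet δ, by simpa using hδ⟩, ⟨Ordinal.toZFSet β, by simpa using hβ⟩]
  simpa [inclusion] using this

theorem exists_isBound_of_velem {κ l : Ordinal} (hκ : IsSuccLimit κ) (hl : IsSuccLimit l)
    (hle : κ ≤ l) (h : VElem κ l) {δ β : Ordinal} (hδ : δ < κ) (hβ : β < l) (hb : IsBound l δ β) :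
    ∃ z < κ, IsBound κ δ z := by
  have hdef : UDef fun α (v : Unit → Vt α) => ∃ z : Vt α, IsBound α (v ()).1.rank z.1.rank :=
    UDef.ex (UDef.isBound (some ()) none)
  obtain ⟨z, hz⟩ := (hdef.velem_iff hκ hl hle h fun _ => ⟨Ordinal.toZFSet δ, by simpa using hδ⟩).1
    ⟨⟨Ordinal.toZFSet β, by simpa using hβ⟩, by simpa [inclusion] using hb⟩
  exact ⟨z.1.rank, z.2, by simpa using hz⟩

theorem IsUplifting.isBound_iff {κ : Ordinal} (h : IsUplifting κ) {δ β : Ordinal} (hδ : δ < κ)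
    (hβ : β < κ) : IsBound κ δ β ↔ ∀ γ, IsTarget (V_ δ) (V_ γ) → γ ≤ β := by
  refine ⟨fun hb γ hγ => ?_, fun hb γ _ => hb γ⟩
  obtain ⟨l, hl, hγl, hκl, hv⟩ := h.2 (succ γ)
  exact (isBound_iff_of_velem h.1.isSuccLimit hl.isSuccLimit hκl.le hv hδ hβ).2 hb γ
    (succ_le_iff.1 hγl) hγ

theorem IsUplifting.menas_eq {κ : Ordinal} (h : IsUplifting κ) {δ : Ordinal} (hδ : δ < κ) :
    menas δ = menasAt κ δ := by
  let S := {β | ∀ γ, IsTarget (V_ δ) (V_ γ) → γ ≤ β}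
  have hS : {β | β < κ ∧ IsBound κ δ β} = {β | β < κ ∧ β ∈ S} :=
    Set.ext fun β => and_congr_right fun hβ => h.isBound_iff hδ hβ
  change sInf S = _
  rw [menasAt, hS]
  rcases S.eq_empty_or_nonempty with he | ⟨b, hb⟩
  · simp [he]
  · obtain ⟨l, hl, hbl, hκl, hv⟩ := h.2 (succ b)
    obtain ⟨z, hz, hzb⟩ := exists_isBound_of_velem h.1.isSuccLimit hl.isSuccLimit hκl.le hv hδ
      (succ_le_iff.1 hbl) fun γ _ => hb γ
    have hzS : z ∈ S := (h.isBound_iff hδ hz).1 hzb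
    refine le_antisymm (csInf_le_csInf' ⟨z, hz, hzS⟩ fun β hβ => hβ.2) (csInf_le' ⟨?_, ?_⟩)
    · exact (csInf_le' hzS).trans_lt hz
    · exact csInf_mem ⟨z, hzS⟩

theorem IsUplifting.exists_le_menasAt {κ : Ordinal} (h : IsUplifting κ) (θ : Ordinal) :
    ∃ l, IsInaccOrd l ∧ κ < l ∧ VElem κ l ∧ θ ≤ menasAt l κ := by
  obtain ⟨γ, hγ, hθγ, hκγ, hv⟩ := h.2 θ
  let T := {l | γ < l ∧ IsInaccOrd l ∧ VElem κ l}
  have hT : T.Nonempty := by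
    obtain ⟨l, hl, hγl, -, hvl⟩ := h.2 (succ γ)
    exact ⟨l, succ_le_iff.1 hγl, hl, hvl⟩
  obtain ⟨hγl, hl, hvl⟩ : sInf T ∈ T := csInf_mem hT
  refine ⟨sInf T, hl, hκγ.trans hγl, hvl, hθγ.trans ?_⟩
  refine le_csInf ⟨γ, hγl, fun γ' hγ' ht => ?_⟩ fun β hβ =>
    hβ.2 γ hγl ((isTarget_iff h.1).2 ⟨hκγ, hγ, hv⟩)
  obtain ⟨-, hinacc, hv'⟩ := (isTarget_iff h.1).1 ht
  exact not_lt.1 fun hlt => hγ'.not_ge (csInf_le' ⟨hlt, hinacc, hv'⟩)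

/-- There is a class function `F : Ord → Ord` such that for every uplifting cardinal `κ`,
`F` maps `κ` into `κ` and `F ↾ κ` has the uplifting Menas property for `κ`. -/
theorem global_menas_function :
    ∃ F : Ordinal → Ordinal, ∀ κ : Ordinal, IsUplifting κ → MenasFor F κ := by
  refine ⟨menas, fun κ h => ⟨fun δ hδ => ?_, fun θ => ?_⟩⟩
  · rw [h.menas_eq hδ]
    exact menasAt_lt h.1.isSuccLimit.bot_lt δ
  · obtain ⟨l, hl, hκl, hv, hθ⟩ := h.exists_le_menasAt θ
    have hlt : ∀ δ, menasAt l δ < l := menasAt_lt hl.isSuccLimit.bot_lt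
    refine ⟨l, menasAt l, hl, hθ.trans (hlt κ).le, hκl, fun δ _ => hlt δ, ?_, hθ⟩
    have := hv.fvelem h.1.isSuccLimit hl.isSuccLimit hκl.le
    rwa [FVElem, ← LFStructure_congr (f := menas)
      (fun δ _ => menasAt_lt h.1.isSuccLimit.bot_lt δ) fun δ hδ => h.menas_eq hδ] at this

end Paper
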